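/- For every sufficiently small δ > 0 there exist constants c, C > 0 (depending only on δ) such that for all real T ≥ 2, the sum over all (a₂,a₃,a₄,a₅) ∈ ℤ⁴ with |aᵢ| ≤ T^i for 2 ≤ i ≤ 5 and f nondegenerate, of the number of pairs (x,y) ∈ ℚ² with y² = f(x), |x| ≥ δ^{−1/δ}·H(f), and H(x) < H(f)^{25/3 − δ}, is at most C·T^{14 − c} (in particular each of these sets of pairs is finite). -/

import Mathlib

/-- The naive height `H(f) = max_{2 ≤ i ≤ 5} |aᵢ|^(1/i)` of
`f(X) = X⁵ + a₂X³ + a₃X² + a₄X + a₅`. -/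
noncomputable def Hf (a₂ a₃ a₄ a₅ : ℤ) : ℝ :=
  max (max ((|a₂| : ℝ) ^ ((1 : ℝ)/2)) ((|a₃| : ℝ) ^ ((1 : ℝ)/3)))
      (max ((|a₄| : ℝ) ^ ((1 : ℝ)/4)) ((|a₅| : ℝ) ^ ((1 : ℝ)/5)))

/-- `f` is nondegenerate: it has five distinct complex roots. -/
def Nondeg (a₂ a₃ a₄ a₅ : ℤ) : Prop :=
  ∃ r : Fin 5 → ℂ, Function.Injective r ∧
    ∀ z : ℂ, z ^ 5 + (a₂ : ℂ) * z ^ 3 + (a₃ : ℂ) * z ^ 2 + (a₄ : ℂ) * z + (a₅ : ℂ) =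
      ∏ i, (z - r i)

/-- The multiplicative height `H(x) = max(|p|, q)` of a rational `x = p/q` in lowest terms. -/
noncomputable def Hq (x : ℚ) : ℝ := max (|x.num| : ℝ) (x.den : ℝ)

/-- Tuples `(a₂,a₃,a₄,a₅,x,y)` where `f` is nondegenerate of height at most `T`, `(x,y)` is an
affine rational point of `y² = f(x)` which is small (`H(x) < H(f)^(25/3 - δ)`) with large
`x`-coordinate (`|x| ≥ δ^(-1/δ)·H(f)`): the union over the family of the sets `I_f^↑`. -/
noncomputable def SmallUpSet (δ T : ℝ) : Set (ℤ × ℤ × ℤ × ℤ × ℚ × ℚ) :=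
  fun p =>
    (|p.1| : ℝ) ≤ T ^ 2 ∧ (|p.2.1| : ℝ) ≤ T ^ 3 ∧ (|p.2.2.1| : ℝ) ≤ T ^ 4 ∧
    (|p.2.2.2.1| : ℝ) ≤ T ^ 5 ∧ Nondeg p.1 p.2.1 p.2.2.1 p.2.2.2.1 ∧
    p.2.2.2.2.2 ^ 2 = p.2.2.2.2.1 ^ 5 + (p.1 : ℚ) * p.2.2.2.2.1 ^ 3 +
      (p.2.1 : ℚ) * p.2.2.2.2.1 ^ 2 + (p.2.2.1 : ℚ) * p.2.2.2.2.1 + (p.2.2.2.1 : ℚ) ∧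
    δ ^ (-(1/δ)) * Hf p.1 p.2.1 p.2.2.1 p.2.2.2.1 ≤ |(p.2.2.2.2.1 : ℝ)| ∧
    Hq p.2.2.2.2.1 < Hf p.1 p.2.1 p.2.2.1 p.2.2.2.1 ^ ((25 : ℝ)/3 - δ)

/-- The divisor bound: the number of divisors of `n` is `O(n ^ ε)` for every `ε > 0`. -/
theorem exists_card_divisors_le_mul_rpow {ε : ℝ} (hε : 0 < ε) :
    ∃ C : ℝ, 0 < C ∧ ∀ n : ℕ, n ≠ 0 → (n.divisors.card : ℝ) ≤ C * (n : ℝ) ^ ε := by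
  have hlog : 0 < Real.log 2 := Real.log_pos (by norm_num)
  set A : ℝ := 1 + 1 / (ε * Real.log 2) with hA
  have hA1 : 1 ≤ A := by rw [hA]; linarith [show 0 < 1 / (ε * Real.log 2) by positivity]
  obtain ⟨N, hN⟩ := exists_nat_gt ((2 : ℝ) ^ (1 / ε))
  have hfactor : ∀ p k : ℕ, p.Prime →
      ((k + 1 : ℕ) : ℝ) ≤ (if p < N then A else 1) * ((p : ℝ) ^ k) ^ ε := by
    intro p k hp
    have hp2 : (2 : ℝ) ≤ p := by exact_mod_cast hp.two_le
    have hcomm : ((p : ℝ) ^ k) ^ ε = ((p : ℝ) ^ ε) ^ k := by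
      rw [← Real.rpow_natCast, ← Real.rpow_mul (by positivity), mul_comm,
        Real.rpow_mul (by positivity), Real.rpow_natCast]
    push_cast
    split_ifs with h
    · have h1 : 1 + (k * ε) * Real.log 2 ≤ ((p : ℝ) ^ k) ^ ε := by
        calc 1 + (k * ε) * Real.log 2 ≤ Real.exp ((k * ε) * Real.log 2) := by
              linarith [Real.add_one_le_exp ((k * ε) * Real.log 2)]
          _ = ((2 : ℝ) ^ k) ^ ε := by
              rw [← Real.rpow_natCast, ← Real.rpow_mul (by norm_num),
                Real.rpow_def_of_pos (by norm_num), mul_comm]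
          _ ≤ _ := by gcongr
      have h2 : A * (1 + (k * ε) * Real.log 2) = A + k * (ε * Real.log 2) + k := by
        rw [hA]; field_simp; ring
      have h3 : 0 ≤ k * (ε * Real.log 2) := by positivity
      calc (k : ℝ) + 1 ≤ A * (1 + (k * ε) * Real.log 2) := by rw [h2]; linarith
        _ ≤ _ := by gcongr
    · have h1 : (2 : ℝ) ≤ (p : ℝ) ^ ε := by
        calc (2 : ℝ) = ((2 : ℝ) ^ (1 / ε)) ^ ε := by
              rw [← Real.rpow_mul (by norm_num), one_div_mul_cancel hε.ne', Real.rpow_one]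
          _ ≤ _ := by
              have : (N : ℝ) ≤ p := by exact_mod_cast not_lt.mp h
              gcongr
              linarith
      rw [one_mul, hcomm]
      calc (k : ℝ) + 1 ≤ 2 ^ k := by exact_mod_cast Nat.lt_two_pow_self
        _ ≤ _ := by gcongr
  refine ⟨A ^ N, by positivity, fun n hn => ?_⟩
  rw [Nat.card_divisors hn, Nat.cast_prod]
  calc ∏ p ∈ n.primeFactors, ((n.factorization p + 1 : ℕ) : ℝ)
      ≤ ∏ p ∈ n.primeFactors,
          ((if p < N then A else 1) * ((p : ℝ) ^ n.factorization p) ^ ε) :=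
        Finset.prod_le_prod (fun _ _ => by positivity)
          fun p hp => hfactor p _ (Nat.prime_of_mem_primeFactors hp)
    _ = (∏ p ∈ n.primeFactors, if p < N then A else 1) * (n : ℝ) ^ ε := by
        rw [Finset.prod_mul_distrib, Real.finsetProd_rpow _ _ (fun _ _ => by positivity)]
        congr 2
        exact_mod_cast Nat.prod_factorization_pow_eq_self hn
    _ ≤ A ^ N * (n : ℝ) ^ ε := by
        gcongr
        rw [← Finset.prod_filter, Finset.prod_const]
        refine pow_le_pow_right₀ hA1 ?_
        calc _ ≤ (Finset.range N).card := Finset.card_le_card fun p hp => by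
              simpa using (Finset.mem_filter.mp hp).2
          _ = N := Finset.card_range N

theorem Finset.card_le_mul_of_card_fiber_le {α β : Type*} [DecidableEq β] (F : Finset α)
    (g : α → β) {n r : ℝ} (hr : 0 ≤ r) (himage : ((F.image g).card : ℝ) ≤ n)
    (hfiber : ∀ b ∈ F.image g, ((F.filter (g · = b)).card : ℝ) ≤ r) :
    (F.card : ℝ) ≤ n * r := by
  rw [Finset.card_eq_sum_card_image g F, Nat.cast_sum]
  calc _ ≤ ∑ _b ∈ F.image g, r := Finset.sum_le_sum hfiber
    _ = (F.image g).card * r := by rw [Finset.sum_const, nsmul_eq_mul]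
    _ ≤ n * r := by gcongr

/-- A set of integers of diameter at most `L * m` whose doubled differences are divisible by `m`
has at most `2 * L + 1` elements. -/
theorem Finset.card_le_of_dvd_two_mul_sub (F : Finset ℤ) {m : ℤ} (hm : 0 < m) {L : ℝ}
    (hL : 0 ≤ L) (hdvd : ∀ x ∈ F, ∀ y ∈ F, m ∣ 2 * (x - y))
    (hdiam : ∀ x ∈ F, ∀ y ∈ F, |(x : ℝ) - y| ≤ L * m) : (F.card : ℝ) ≤ 2 * L + 1 := by
  rcases F.eq_empty_or_nonempty with rfl | hF
  · simp; linarith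
  set x₀ := F.min' hF
  have hx₀ : x₀ ∈ F := F.min'_mem hF
  have hmR : (0 : ℝ) < m := by exact_mod_cast hm
  have hcard : F.card ≤ (Finset.Icc (0 : ℤ) ⌊2 * L⌋).card := by
    refine Finset.card_le_card_of_injOn (fun x => 2 * (x - x₀) / m) (fun x hx => ?_)
      fun x hx y hy hxy => ?_
    · have hle : x₀ ≤ x := F.min'_le x hx
      obtain ⟨k, hk⟩ := hdvd x hx x₀ hx₀
      have hkR : 2 * ((x : ℝ) - x₀) = m * k := by exact_mod_cast hk
      have h1 := (le_abs_self _).trans (hdiam x hx x₀ hx₀)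
      simp only [hk, Int.mul_ediv_cancel_left _ hm.ne', Finset.coe_Icc, Set.mem_Icc]
      constructor
      · nlinarith
      · rw [Int.le_floor]
        refine le_of_mul_le_mul_left ?_ hmR
        linarith
    · obtain ⟨k, hk⟩ := hdvd x hx x₀ hx₀
      obtain ⟨l, hl⟩ := hdvd y hy x₀ hx₀
      simp only [hk, hl, Int.mul_ediv_cancel_left _ hm.ne'] at hxy
      subst hxy
      linarith
  have hfloor : (0 : ℤ) ≤ ⌊2 * L⌋ := Int.floor_nonneg.mpr (by positivity)
  rw [Int.card_Icc, sub_zero] at hcard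
  calc (F.card : ℝ) ≤ ((⌊2 * L⌋ + 1).toNat : ℝ) := by exact_mod_cast hcard
    _ = (⌊2 * L⌋ : ℝ) + 1 := by
        have : (((⌊2 * L⌋ + 1).toNat : ℤ) : ℝ) = ((⌊2 * L⌋ + 1 : ℤ) : ℝ) := by
          rw [Int.toNat_of_nonneg (by linarith)]
        push_cast at this
        exact_mod_cast this
    _ ≤ 2 * L + 1 := by linarith [Int.floor_le (2 * L)]

/-- Square roots of a common residue class modulo `m` that are prime to `m`, and have the same
greatest common divisor of `m` and their distance to a fixed root, agree modulo `m` up to `2`. -/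
theorem dvd_two_mul_sub_of_gcd_eq {m t t' t₀ : ℤ} (hm : m ≠ 0) (hco : IsCoprime t₀ m)
    (ht : m ∣ t ^ 2 - t₀ ^ 2) (ht' : m ∣ t' ^ 2 - t₀ ^ 2)
    (hgcd : Int.gcd (t - t₀) m = Int.gcd (t' - t₀) m) : m ∣ 2 * (t - t') := by
  set e : ℤ := (Int.gcd (t - t₀) m : ℤ) with he
  have he0 : e ≠ 0 := by
    rw [he]; exact_mod_cast (Int.gcd_pos_of_ne_zero_right _ hm).ne'
  obtain ⟨q, hq⟩ : e ∣ m := Int.gcd_dvd_right ..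
  have key : ∀ u : ℤ, m ∣ u ^ 2 - t₀ ^ 2 → (Int.gcd (u - t₀) m : ℤ) = e →
      e ∣ u - t₀ ∧ q ∣ u + t₀ := by
    intro u hu hue
    have h1 : e ∣ u - t₀ := hue ▸ Int.gcd_dvd_left ..
    refine ⟨h1, ?_⟩
    obtain ⟨v, hv⟩ := h1
    have hcop : IsCoprime q v := by
      have := Int.gcd_eq_gcd_ab (u - t₀) m
      rw [hue] at this
      refine ⟨Int.gcdB (u - t₀) m, Int.gcdA (u - t₀) m, ?_⟩
      refine mul_left_cancel₀ he0 ?_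
      linear_combination (-1 : ℤ) * this + Int.gcdA (u - t₀) m * (-hv) + Int.gcdB (u - t₀) m * (-hq)
    have h2 : e * q ∣ e * (v * (u + t₀)) := by
      rw [← hq, ← mul_assoc, ← hv]
      convert hu using 1; ring
    exact hcop.dvd_of_dvd_mul_left ((mul_dvd_mul_iff_left he0).mp h2)
  obtain ⟨⟨a, ha⟩, ⟨b, hb⟩⟩ := key t ht rfl
  obtain ⟨⟨a', ha'⟩, ⟨b', hb'⟩⟩ := key t' ht' (by rw [he, hgcd])
  obtain ⟨x, y, hxy⟩ := hco
  -- `2 t₀ = q b - e a` and `x t₀ + y m = 1`, so that `2` is a combination of `e` and `q`.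
  refine ⟨x * ((b * (a - a')) - a * (b - b')) + 2 * y * (t - t'), ?_⟩
  have e1 : t - t' = e * (a - a') := by linear_combination ha - ha'
  have e2 : t - t' = q * (b - b') := by linear_combination hb - hb'
  have e3 : 2 * t₀ = q * b - e * a := by linear_combination hb - ha
  linear_combination (-2 * (t - t')) * hxy + x * (t - t') * e3 + x * q * b * e1
    - x * e * a * e2 - x * (b * (a - a') - a * (b - b')) * hq

theorem card_le_of_sq_eq_add {s d : ℕ} (hs : 0 < s) (hd : 0 < d)
    (hsd : IsCoprime (s : ℤ) (d : ℤ)) {U : ℝ} (hU : 0 ≤ U) (a : ℤ) (F : Finset ℤ)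
    (hF : ∀ t ∈ F, (s : ℝ) ^ 5 ≤ 2 * (t : ℝ) ^ 2 ∧
      ∃ r : ℤ, t ^ 2 = s ^ 5 + a * s ^ 3 * d ^ 4 + d ^ 6 * r ∧ |(r : ℝ)| ≤ 3 * U ^ 3 * s ^ 2) :
    (F.card : ℝ) ≤ 2 * (d ^ 6).divisors.card * (2 * (6 * U ^ 3 / √s) + 1) := by
  rcases F.eq_empty_or_nonempty with rfl | ⟨t₀, ht₀⟩
  · simp only [Finset.card_empty, Nat.cast_zero]; positivity
  have hsR : (0 : ℝ) < s := by exact_mod_cast hs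
  have hdR : (0 : ℝ) < d := by exact_mod_cast hd
  have hm : (0 : ℤ) < (d : ℤ) ^ 6 := by positivity
  have hsq : ∀ t ∈ F, ∀ t' ∈ F, (d : ℤ) ^ 6 ∣ t ^ 2 - t' ^ 2 := by
    intro t ht t' ht'
    obtain ⟨-, r, hr, -⟩ := hF t ht
    obtain ⟨-, r', hr', -⟩ := hF t' ht'
    exact ⟨r - r', by rw [hr, hr']; ring⟩
  have hcop : IsCoprime t₀ ((d : ℤ) ^ 6) := by
    obtain ⟨-, r, hr, -⟩ := hF t₀ ht₀
    have h : t₀ ^ 2 = s ^ 5 + d * (a * s ^ 3 * d ^ 3 + d ^ 5 * r) := by rw [hr]; ring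
    have h' : IsCoprime (t₀ ^ 2) (d : ℤ) := by
      rw [h]; exact (hsd.pow_left).add_mul_left_left _
    exact ((IsCoprime.pow_left_iff two_pos).mp h').pow_right
  refine Finset.card_le_mul_of_card_fiber_le F
    (fun t => (decide (0 < t), Int.gcd (t - t₀) ((d : ℤ) ^ 6))) (by positivity) ?_ ?_
  · have : (F.image fun t => (decide (0 < t), Int.gcd (t - t₀) ((d : ℤ) ^ 6))) ⊆
        (Finset.univ : Finset Bool) ×ˢ (d ^ 6).divisors := by
      intro b hb
      obtain ⟨t, -, rfl⟩ := Finset.mem_image.mp hb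
      simp only [Finset.mem_product, Finset.mem_univ, true_and, Nat.mem_divisors]
      refine ⟨?_, by positivity⟩
      have := Int.gcd_dvd_right (t - t₀) ((d : ℤ) ^ 6)
      exact_mod_cast this
    have := Finset.card_le_card this
    rw [Finset.card_product, Finset.card_univ, Fintype.card_bool] at this
    exact_mod_cast this
  · intro b _
    refine Finset.card_le_of_dvd_two_mul_sub _ hm (by positivity) ?_ ?_
    · intro t ht t' ht'
      rw [Finset.mem_filter] at ht ht'
      refine dvd_two_mul_sub_of_gcd_eq hm.ne' hcop (hsq t ht.1 t₀ ht₀) (hsq t' ht'.1 t₀ ht₀) ?_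
      exact congrArg Prod.snd (ht.2.trans ht'.2.symm)
    · intro t ht t' ht'
      rw [Finset.mem_filter] at ht ht'
      have hsign : 0 < t ↔ 0 < t' := by
        simpa using congrArg Prod.fst (ht.2.trans ht'.2.symm)
      obtain ⟨h1, r, hr, hr3⟩ := hF t ht.1
      obtain ⟨h1', r', hr', hr3'⟩ := hF t' ht'.1
      set w : ℝ := √s with hw
      have hw0 : 0 < w := Real.sqrt_pos.mpr hsR
      have hws : (s : ℝ) = w ^ 2 := (Real.sq_sqrt hsR.le).symm
      have hlow : ∀ u : ℤ, (s : ℝ) ^ 5 ≤ 2 * (u : ℝ) ^ 2 → w ^ 5 ≤ 2 * |(u : ℝ)| := by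
        intro u hu
        refine le_of_sq_le_sq ?_ (by positivity)
        rw [mul_pow, sq_abs]
        rw [hws] at hu
        nlinarith [sq_nonneg (u : ℝ)]
      have hsum : w ^ 5 ≤ |(t : ℝ) + t'| := by
        have e := hlow t h1
        have e' := hlow t' h1'
        by_cases h : 0 < t
        · have a1 : (0 : ℝ) < t := by exact_mod_cast h
          have a2 : (0 : ℝ) < t' := by exact_mod_cast hsign.mp h
          rw [abs_of_pos a1] at e
          rw [abs_of_pos a2] at e'
          rw [abs_of_pos (by linarith)]; linarith
        · have a1 : (t : ℝ) ≤ 0 := by exact_mod_cast not_lt.mp h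
          have a2 : (t' : ℝ) ≤ 0 := by exact_mod_cast not_lt.mp (fun h' => h (hsign.mpr h'))
          rw [abs_of_nonpos a1] at e
          rw [abs_of_nonpos a2] at e'
          rw [abs_of_nonpos (by linarith)]; linarith
      have hprod : |(t : ℝ) - t'| * |(t : ℝ) + t'| ≤ 6 * U ^ 3 * s ^ 2 * d ^ 6 := by
        have hR : (t : ℝ) ^ 2 = s ^ 5 + a * s ^ 3 * d ^ 4 + d ^ 6 * r := by exact_mod_cast hr
        have hR' : (t' : ℝ) ^ 2 = s ^ 5 + a * s ^ 3 * d ^ 4 + d ^ 6 * r' := by exact_mod_cast hr'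
        have : ((t : ℝ) - t') * (t + t') = d ^ 6 * (r - r') := by
          linear_combination hR - hR'
        rw [← abs_mul, this, abs_mul, abs_of_pos (by positivity : (0 : ℝ) < d ^ 6)]
        have := abs_sub (r : ℝ) r'
        calc (d : ℝ) ^ 6 * |(r : ℝ) - r'| ≤ d ^ 6 * (6 * U ^ 3 * s ^ 2) := by
              gcongr; linarith
          _ = _ := by ring
      have hfin : |(t : ℝ) - t'| * w ^ 5 ≤ 6 * U ^ 3 / w * d ^ 6 * w ^ 5 := by
        calc |(t : ℝ) - t'| * w ^ 5 ≤ |(t : ℝ) - t'| * |(t : ℝ) + t'| := by gcongr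
          _ ≤ _ := hprod
          _ = _ := by rw [hws]; field_simp
      push_cast
      exact le_of_mul_le_mul_right hfin (by positivity)

/-- Integers `x` with `x * s + d ^ 2 * r` constant, for bounded `r`. -/
theorem card_le_of_mul_add_eq {s d : ℕ} (hs : 0 < s) (hd : 0 < d)
    (hsd : IsCoprime (s : ℤ) (d : ℤ)) {B : ℝ} (hB : 0 ≤ B) (N : ℤ) (F : Finset ℤ)
    (hF : ∀ x ∈ F, ∃ r : ℤ, x * s + d ^ 2 * r = N ∧ |(r : ℝ)| ≤ B) :
    (F.card : ℝ) ≤ 4 * B / s + 1 := by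
  have hsR : (0 : ℝ) < s := by exact_mod_cast hs
  have hdR : (0 : ℝ) < d := by exact_mod_cast hd
  have h := Finset.card_le_of_dvd_two_mul_sub F (m := (d : ℤ) ^ 2) (by positivity)
    (L := 2 * B / s) (by positivity) ?_ ?_
  · exact h.trans_eq (by ring)
  · intro x hx y hy
    obtain ⟨r, hr, -⟩ := hF x hx
    obtain ⟨r', hr', -⟩ := hF y hy
    refine Dvd.dvd.mul_left ?_ 2
    refine (hsd.symm.pow_left (m := 2)).dvd_of_dvd_mul_right (z := (s : ℤ)) ⟨r' - r, ?_⟩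
    linear_combination hr - hr'
  · intro x hx y hy
    obtain ⟨r, hr, hrB⟩ := hF x hx
    obtain ⟨r', hr', hrB'⟩ := hF y hy
    have hR : (x : ℝ) * s + d ^ 2 * r = N := by exact_mod_cast hr
    have hR' : (y : ℝ) * s + d ^ 2 * r' = N := by exact_mod_cast hr'
    have e : ((x : ℝ) - y) * s = d ^ 2 * (r' - r) := by linear_combination hR - hR'
    refine le_of_mul_le_mul_right ?_ hsR
    calc |(x : ℝ) - y| * s = |d ^ 2 * ((r' : ℝ) - r)| := by
          rw [← e, abs_mul, abs_of_pos hsR]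
      _ = d ^ 2 * |(r' : ℝ) - r| := by rw [abs_mul, abs_of_pos (by positivity)]
      _ ≤ d ^ 2 * (2 * B) := by
          gcongr
          linarith [abs_sub (r' : ℝ) r]
      _ = _ := by push_cast; field_simp

/-- The integral tuples `(a₂, t, a₃, a₄, a₅)` for which `(s / d ^ 2, t / d ^ 5)` lies on
`y² = x⁵ + a₂x³ + a₃x² + a₄x + a₅`, with the size constraints that hold when the height of this
polynomial is at most `U` and `s / d ^ 2` is large compared to it. -/
structure IsLargePoint (U : ℝ) (s d : ℕ) (p : ℤ × ℤ × ℤ × ℤ × ℤ) : Prop where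
  eq : p.2.1 ^ 2 = (s : ℤ) ^ 5 + p.1 * s ^ 3 * d ^ 4 +
    d ^ 6 * (p.2.2.1 * s ^ 2 + d ^ 2 * (p.2.2.2.1 * s + d ^ 2 * p.2.2.2.2))
  le_sq : (s : ℝ) ^ 5 ≤ 2 * (p.2.1 : ℝ) ^ 2
  abs_a₂_le : |(p.1 : ℝ)| ≤ U ^ 2
  abs_tail₃_le : |((p.2.2.1 * s ^ 2 + d ^ 2 * (p.2.2.2.1 * s + d ^ 2 * p.2.2.2.2) : ℤ) : ℝ)| ≤
    3 * U ^ 3 * s ^ 2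
  abs_tail₄_le : |((p.2.2.2.1 * s + d ^ 2 * p.2.2.2.2 : ℤ) : ℝ)| ≤ 2 * U ^ 4 * s
  abs_a₅_le : |(p.2.2.2.2 : ℝ)| ≤ U ^ 5

theorem card_le_of_isLargePoint {s d : ℕ} (hs : 0 < s) (hd : 0 < d)
    (hsd : IsCoprime (s : ℤ) (d : ℤ)) {U : ℝ} (hU : 1 ≤ U) (F : Finset (ℤ × ℤ × ℤ × ℤ × ℤ))
    (hF : ∀ p ∈ F, IsLargePoint U s d p) :
    (F.card : ℝ) ≤ 3 * U ^ 2 * (2 * (d ^ 6).divisors.card * (2 * (6 * U ^ 3 / √s) + 1) *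
      ((4 * (2 * U ^ 4) / s + 1) * (4 * U ^ 5 / s + 1))) := by
  refine Finset.card_le_mul_of_card_fiber_le F (fun p => p.1) (by positivity) ?_ fun a₂ _ => ?_
  · have hsub : F.image (fun p => p.1) ⊆ Finset.Icc (-⌊U ^ 2⌋) ⌊U ^ 2⌋ := by
      intro a ha
      obtain ⟨p, hp, rfl⟩ := Finset.mem_image.mp ha
      have h := abs_le.mp (hF p hp).abs_a₂_le
      rw [Finset.mem_Icc, neg_le, Int.le_floor, Int.le_floor]
      push_cast
      exact ⟨by linarith, h.2⟩
    have hcard := Finset.card_le_card hsub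
    have h0 : (0 : ℤ) ≤ ⌊U ^ 2⌋ := Int.floor_nonneg.mpr (by positivity)
    have h2 : ((F.image (fun p => p.1)).card : ℤ) ≤ 2 * ⌊U ^ 2⌋ + 1 := by
      rw [Int.card_Icc] at hcard
      omega
    have h3 : ((F.image (fun p => p.1)).card : ℝ) ≤ 2 * ⌊U ^ 2⌋ + 1 := by exact_mod_cast h2
    have := Int.floor_le (U ^ 2)
    nlinarith
  refine Finset.card_le_mul_of_card_fiber_le _ (fun p => p.2.1) (by positivity) ?_ fun t _ => ?_
  · refine card_le_of_sq_eq_add hs hd hsd (by linarith) a₂ _ fun t ht => ?_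
    simp only [Finset.mem_image, Finset.mem_filter] at ht
    obtain ⟨p, ⟨hp, rfl⟩, rfl⟩ := ht
    exact ⟨(hF p hp).le_sq, _, (hF p hp).eq, (hF p hp).abs_tail₃_le⟩
  have hd' : (d : ℤ) ≠ 0 := by exact_mod_cast hd.ne'
  have hs' : (s : ℤ) ≠ 0 := by exact_mod_cast hs.ne'
  refine Finset.card_le_mul_of_card_fiber_le _ (fun p => p.2.2.1) (by positivity) ?_
    fun a₃ _ => ?_
  · have hB : 4 * (2 * U ^ 4) / (s : ℝ) = 4 * (2 * U ^ 4 * s) / ((s ^ 2 : ℕ) : ℝ) := by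
      have : (s : ℝ) ≠ 0 := by exact_mod_cast hs.ne'
      push_cast; field_simp
    rw [hB]
    refine card_le_of_mul_add_eq (by positivity) hd (by push_cast; exact hsd.pow_left)
      (by positivity) ((t ^ 2 - (s ^ 5 + a₂ * s ^ 3 * d ^ 4)) / d ^ 6) _ fun a₃ ha₃ => ?_
    simp only [Finset.mem_image, Finset.mem_filter] at ha₃
    obtain ⟨p, ⟨⟨hp, rfl⟩, rfl⟩, rfl⟩ := ha₃
    refine ⟨p.2.2.2.1 * s + d ^ 2 * p.2.2.2.2, ?_, (hF p hp).abs_tail₄_le⟩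
    rw [(hF p hp).eq, add_sub_cancel_left, Int.mul_ediv_cancel_left _ (by positivity)]
    push_cast; ring
  obtain hempty | ⟨p₀, hp₀⟩ := Finset.eq_empty_or_nonempty
    ({p ∈ {p ∈ {p ∈ F | p.1 = a₂} | p.2.1 = t} | p.2.2.1 = a₃})
  · rw [hempty]; simp only [Finset.card_empty, Nat.cast_zero]; positivity
  have htail : ∀ p ∈ ({p ∈ {p ∈ {p ∈ F | p.1 = a₂} | p.2.1 = t} | p.2.2.1 = a₃}),
      p.2.2.2.1 * (s : ℤ) + d ^ 2 * p.2.2.2.2 = p₀.2.2.2.1 * s + d ^ 2 * p₀.2.2.2.2 := by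
    intro p hp
    simp only [Finset.mem_filter] at hp hp₀
    obtain ⟨⟨⟨hp, rfl⟩, rfl⟩, rfl⟩ := hp
    obtain ⟨⟨⟨hp₀, h₁⟩, h₂⟩, h₃⟩ := hp₀
    have e := (hF p hp).eq
    have e₀ := (hF p₀ hp₀).eq
    rw [h₁, h₂, h₃, e] at e₀
    refine mul_left_cancel₀ (pow_ne_zero 8 hd') ?_
    linear_combination e₀
  have hinj : Set.InjOn (fun p : ℤ × ℤ × ℤ × ℤ × ℤ => p.2.2.2.1)
      ({p ∈ {p ∈ {p ∈ F | p.1 = a₂} | p.2.1 = t} | p.2.2.1 = a₃} :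
        Finset (ℤ × ℤ × ℤ × ℤ × ℤ)) := by
    intro p hp q hq hpq
    have hp' := htail p hp
    have hq' := htail q hq
    simp only [Finset.coe_filter, Finset.mem_filter, Set.mem_ofPred_eq] at hp hq
    obtain ⟨⟨⟨-, h₁⟩, h₂⟩, h₃⟩ := hp
    obtain ⟨⟨⟨-, h₁'⟩, h₂'⟩, h₃'⟩ := hq
    simp only at hpq
    refine Prod.ext (h₁.trans h₁'.symm) (Prod.ext (h₂.trans h₂'.symm)
      (Prod.ext (h₃.trans h₃'.symm) (Prod.ext hpq ?_)))
    rw [hpq] at hp'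
    refine mul_left_cancel₀ (pow_ne_zero 2 hd') ?_
    linear_combination hp' - hq'
  rw [← Finset.card_image_of_injOn hinj]
  refine card_le_of_mul_add_eq hs hd hsd (by positivity)
    (p₀.2.2.2.1 * s + d ^ 2 * p₀.2.2.2.2) _ fun a₄ ha₄ => ?_
  obtain ⟨p, hp, rfl⟩ := Finset.mem_image.mp ha₄
  refine ⟨p.2.2.2.2, htail p hp, ?_⟩
  simp only [Finset.mem_filter] at hp
  exact (hF p hp.1.1.1).abs_a₅_le

theorem IsLargePoint.mono {U V : ℝ} (hU : 0 ≤ U) (hUV : U ≤ V) {s d : ℕ}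
    {p : ℤ × ℤ × ℤ × ℤ × ℤ} (h : IsLargePoint U s d p) : IsLargePoint V s d p where
  eq := h.eq
  le_sq := h.le_sq
  abs_a₂_le := h.abs_a₂_le.trans (by gcongr)
  abs_tail₃_le := h.abs_tail₃_le.trans (by gcongr)
  abs_tail₄_le := h.abs_tail₄_le.trans (by gcongr)
  abs_a₅_le := h.abs_a₅_le.trans (by gcongr)

/-- A rational point on `y² = x⁵ + a₂x³ + a₃x² + a₄x + a₅` has the form `(s / d ^ 2, t / d ^ 5)`
in lowest terms. -/
theorem exists_den_eq_sq {a₂ a₃ a₄ a₅ : ℤ} {x y : ℚ}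
    (h : y ^ 2 = x ^ 5 + a₂ * x ^ 3 + a₃ * x ^ 2 + a₄ * x + a₅) :
    ∃ d : ℕ, x.den = d ^ 2 ∧ y.den = d ^ 5 ∧
      y.num ^ 2 = x.num ^ 5 + a₂ * x.num ^ 3 * d ^ 4 +
        d ^ 6 * (a₃ * x.num ^ 2 + d ^ 2 * (a₄ * x.num + d ^ 2 * a₅)) := by
  have hq : (x.den : ℚ) ≠ 0 := by exact_mod_cast x.den_nz
  have hv : (y.den : ℚ) ≠ 0 := by exact_mod_cast y.den_nz
  set M : ℤ := x.num ^ 5 + x.den * (a₂ * x.num ^ 3 * x.den + a₃ * x.num ^ 2 * x.den ^ 2 +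
    a₄ * x.num * x.den ^ 3 + a₅ * x.den ^ 4) with hM
  have hMq : IsCoprime ((x.den : ℤ) ^ 5) M := by
    refine IsCoprime.pow_left ?_
    rw [hM, isCoprime_comm]
    exact ((Rat.isCoprime_num_den x).pow_left).add_mul_left_left _
  have hyv : IsCoprime ((y.den : ℤ) ^ 2) (y.num ^ 2) := (Rat.isCoprime_num_den y).symm.pow
  have key : y.num ^ 2 * (x.den : ℤ) ^ 5 = y.den ^ 2 * M := by
    have hx := Rat.num_div_den x
    have hy := Rat.num_div_den y
    rw [← hx, ← hy] at h
    field_simp at h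
    have : (y.num : ℚ) ^ 2 * (x.den : ℚ) ^ 5 = y.den ^ 2 * M := by
      rw [hM]; push_cast; linear_combination h
    exact_mod_cast this
  have h1 : (x.den : ℤ) ^ 5 ∣ y.den ^ 2 :=
    hMq.dvd_of_dvd_mul_right (Dvd.intro_left _ key)
  have h2 : (y.den : ℤ) ^ 2 ∣ x.den ^ 5 :=
    hyv.dvd_of_dvd_mul_left (Dvd.intro _ key.symm)
  have h3 : y.den ^ 2 = x.den ^ 5 :=
    Nat.dvd_antisymm (by exact_mod_cast h2) (by exact_mod_cast h1)
  obtain ⟨d, hd⟩ : x.den ^ 2 ∣ y.den := by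
    rw [← Nat.pow_dvd_pow_iff two_ne_zero, h3]
    exact ⟨x.den, by ring⟩
  have hxd : x.den = d ^ 2 := by
    have hpos : 0 < x.den ^ 4 := pow_pos x.den_pos 4
    refine Nat.eq_of_mul_eq_mul_left hpos ?_
    calc x.den ^ 4 * x.den = y.den ^ 2 := by rw [h3]; ring
      _ = _ := by rw [hd]; ring
  refine ⟨d, hxd, by rw [hd, hxd]; ring, ?_⟩
  have h4 : y.num ^ 2 = M := by
    have hne : (x.den : ℤ) ^ 5 ≠ 0 := pow_ne_zero _ (by exact_mod_cast x.den_nz)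
    refine mul_right_cancel₀ hne ?_
    have h3' : (y.den : ℤ) ^ 2 = x.den ^ 5 := by exact_mod_cast h3
    rw [key, h3']; ring
  rw [h4, hM, hxd]
  push_cast; ring

theorem isLargePoint_of_height {H : ℝ} (hH : 1 ≤ H) {a₂ a₃ a₄ a₅ s t : ℤ} {d : ℕ} (hd : 0 < d)
    (h₂ : |(a₂ : ℝ)| ≤ H ^ 2) (h₃ : |(a₃ : ℝ)| ≤ H ^ 3) (h₄ : |(a₄ : ℝ)| ≤ H ^ 4)
    (h₅ : |(a₅ : ℝ)| ≤ H ^ 5) (hs : 4 * (H * d ^ 2) ≤ |(s : ℝ)|)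
    (heq : t ^ 2 = s ^ 5 + a₂ * s ^ 3 * d ^ 4 +
        d ^ 6 * (a₃ * s ^ 2 + d ^ 2 * (a₄ * s + d ^ 2 * a₅))) :
    0 < s ∧ IsLargePoint H s.natAbs d (a₂, t, a₃, a₄, a₅) := by
  have hdR : (0 : ℝ) < d := by exact_mod_cast hd
  set D : ℝ := (d : ℝ) ^ 2 with hD
  have hD0 : 0 < D := by positivity
  set σ : ℝ := |(s : ℝ)| with hσ
  have hHD : 0 < H * D := by positivity
  have hσ0 : 0 < σ := by linarith
  have b₄ : |(a₄ * s + D * a₅ : ℝ)| ≤ 2 * H ^ 4 * σ := by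
    calc |(a₄ * s + D * a₅ : ℝ)| ≤ |(a₄ : ℝ)| * σ + D * |(a₅ : ℝ)| := by
          refine (abs_add_le _ _).trans_eq ?_
          rw [abs_mul, abs_mul, abs_of_pos hD0]
      _ ≤ H ^ 4 * σ + D * H ^ 5 := by gcongr
      _ = H ^ 4 * σ + H ^ 4 * (H * D) := by ring
      _ ≤ H ^ 4 * σ + H ^ 4 * σ := by gcongr; linarith
      _ = _ := by ring
  have b₃ : |(a₃ * s ^ 2 + D * (a₄ * s + D * a₅) : ℝ)| ≤ 3 * H ^ 3 * σ ^ 2 := by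
    calc |(a₃ * s ^ 2 + D * (a₄ * s + D * a₅) : ℝ)|
        ≤ |(a₃ : ℝ)| * σ ^ 2 + D * |(a₄ * s + D * a₅ : ℝ)| := by
          refine (abs_add_le _ _).trans_eq ?_
          rw [abs_mul, abs_mul, abs_of_pos hD0, abs_pow]
      _ ≤ H ^ 3 * σ ^ 2 + D * (2 * H ^ 4 * σ) := by gcongr
      _ = H ^ 3 * σ ^ 2 + 2 * H ^ 3 * (H * D) * σ := by ring
      _ ≤ H ^ 3 * σ ^ 2 + 2 * H ^ 3 * σ * σ := by gcongr; linarith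
      _ = _ := by ring
  have hR : (t : ℝ) ^ 2 = s ^ 5 + (a₂ * s ^ 3 * D ^ 2 +
      D ^ 3 * (a₃ * s ^ 2 + D * (a₄ * s + D * a₅))) := by
    have : (t : ℝ) ^ 2 = s ^ 5 + a₂ * s ^ 3 * d ^ 4 +
        d ^ 6 * (a₃ * s ^ 2 + d ^ 2 * (a₄ * s + d ^ 2 * a₅)) := by exact_mod_cast heq
    rw [this, hD]; ring
  have b : |(a₂ * s ^ 3 * D ^ 2 + D ^ 3 * (a₃ * s ^ 2 + D * (a₄ * s + D * a₅)) : ℝ)| ≤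
      σ ^ 5 / 2 := by
    calc _ ≤ |(a₂ : ℝ)| * σ ^ 3 * D ^ 2 +
          D ^ 3 * |(a₃ * s ^ 2 + D * (a₄ * s + D * a₅) : ℝ)| := by
          refine (abs_add_le _ _).trans_eq ?_
          rw [abs_mul, abs_mul, abs_mul, abs_pow, abs_of_pos (pow_pos hD0 2),
            abs_of_pos (pow_pos hD0 3)]
      _ ≤ H ^ 2 * σ ^ 3 * D ^ 2 + D ^ 3 * (3 * H ^ 3 * σ ^ 2) := by gcongr
      _ = (H * D) ^ 2 * σ ^ 3 + 3 * (H * D) ^ 3 * σ ^ 2 := by ring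
      _ ≤ (σ / 4) ^ 2 * σ ^ 3 + 3 * (σ / 4) ^ 3 * σ ^ 2 := by gcongr <;> linarith
      _ ≤ σ ^ 5 / 2 := by nlinarith [pow_pos hσ0 5]
  have hspos : 0 < s := by
    by_contra hneg
    have hneg' : (s : ℝ) ≤ 0 := by exact_mod_cast not_lt.mp hneg
    have hsσ : (s : ℝ) = -σ := by rw [hσ, abs_of_nonpos hneg']; ring
    have := (abs_le.mp b).2
    have e : (s : ℝ) ^ 5 = -σ ^ 5 := by rw [hsσ]; ring
    nlinarith [sq_nonneg (t : ℝ), pow_pos hσ0 5]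
  have hsR : (s : ℝ) = σ := (abs_of_pos (by exact_mod_cast hspos)).symm
  have hnat : ((s.natAbs : ℕ) : ℤ) = s := Int.natAbs_of_nonneg hspos.le
  have hnatR : ((s.natAbs : ℕ) : ℝ) = σ := by
    rw [Nat.cast_natAbs, Int.cast_abs]
  refine ⟨hspos, ?_, ?_, h₂, ?_, ?_, h₅⟩
  · simpa only [hnat] using heq
  · simp only [hnatR]
    have := (abs_le.mp b).1
    rw [hsR] at hR this
    linarith
  · simp only [hnat, hnatR]
    push_cast
    exact b₃
  · simp only [hnat, hnatR]
    push_cast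
    exact b₄

section Height

variable {a₂ a₃ a₄ a₅ : ℤ}

theorem Hf_nonneg : 0 ≤ Hf a₂ a₃ a₄ a₅ :=
  le_trans (by positivity) ((le_max_left _ _).trans (le_max_left _ _))

theorem abs_le_pow_of_rpow_le {z : ℝ} {H : ℝ} {k : ℕ} (hk : k ≠ 0)
    (h : |z| ^ ((1 : ℝ) / k) ≤ H) : |z| ≤ H ^ k := by
  calc |z| = (|z| ^ ((1 : ℝ) / k)) ^ k := by
        rw [one_div, Real.rpow_inv_natCast_pow (abs_nonneg z) hk]
    _ ≤ H ^ k := by gcongr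

theorem abs_coeff_le_Hf_pow :
    |(a₂ : ℝ)| ≤ Hf a₂ a₃ a₄ a₅ ^ 2 ∧ |(a₃ : ℝ)| ≤ Hf a₂ a₃ a₄ a₅ ^ 3 ∧
      |(a₄ : ℝ)| ≤ Hf a₂ a₃ a₄ a₅ ^ 4 ∧ |(a₅ : ℝ)| ≤ Hf a₂ a₃ a₄ a₅ ^ 5 := by
  have h := le_refl (Hf a₂ a₃ a₄ a₅)
  conv_lhs at h => unfold Hf
  simp only [max_le_iff] at h
  obtain ⟨⟨h₂, h₃⟩, h₄, h₅⟩ := h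
  exact ⟨abs_le_pow_of_rpow_le two_ne_zero (by exact_mod_cast h₂),
    abs_le_pow_of_rpow_le three_ne_zero (by exact_mod_cast h₃),
    abs_le_pow_of_rpow_le four_ne_zero (by exact_mod_cast h₄),
    abs_le_pow_of_rpow_le (by norm_num : (5 : ℕ) ≠ 0) (by exact_mod_cast h₅)⟩

theorem Hf_le {T : ℝ} (hT : 0 ≤ T) (h₂ : |(a₂ : ℝ)| ≤ T ^ 2) (h₃ : |(a₃ : ℝ)| ≤ T ^ 3)
    (h₄ : |(a₄ : ℝ)| ≤ T ^ 4) (h₅ : |(a₅ : ℝ)| ≤ T ^ 5) : Hf a₂ a₃ a₄ a₅ ≤ T := by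
  have key : ∀ (z : ℝ) (k : ℕ), k ≠ 0 → |z| ≤ T ^ k → |z| ^ ((1 : ℝ) / k) ≤ T := by
    intro z k hk hz
    calc |z| ^ ((1 : ℝ) / k) ≤ (T ^ k) ^ ((1 : ℝ) / k) := by gcongr
      _ = T := by rw [one_div, Real.pow_rpow_inv_natCast hT hk]
  refine max_le (max_le ?_ ?_) (max_le ?_ ?_)
  · exact_mod_cast key _ 2 two_ne_zero h₂
  · exact_mod_cast key _ 3 three_ne_zero h₃
  · exact_mod_cast key _ 4 four_ne_zero h₄
  · exact_mod_cast key _ 5 (by norm_num) h₅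

theorem one_le_Hf (h : Nondeg a₂ a₃ a₄ a₅) : 1 ≤ Hf a₂ a₃ a₄ a₅ := by
  by_contra hlt
  rw [not_le] at hlt
  have hzero : ∀ (a : ℤ) (k : ℕ), k ≠ 0 → |(a : ℝ)| ≤ Hf a₂ a₃ a₄ a₅ ^ k → a = 0 := by
    intro a k hk ha
    have h1 := ha.trans_lt (pow_lt_one₀ Hf_nonneg hlt hk)
    rw [← Int.abs_lt_one_iff]
    exact_mod_cast h1
  obtain ⟨h₂, h₃, h₄, h₅⟩ := abs_coeff_le_Hf_pow (a₂ := a₂) (a₃ := a₃) (a₄ := a₄) (a₅ := a₅)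
  have e₂ := hzero _ 2 two_ne_zero h₂
  have e₃ := hzero _ 3 three_ne_zero h₃
  have e₄ := hzero _ 4 four_ne_zero h₄
  have e₅ := hzero _ 5 (by norm_num) h₅
  obtain ⟨r, hr, hprod⟩ := h
  have hroot : ∀ i, r i = 0 := by
    intro i
    have := hprod (r i)
    rw [Finset.prod_eq_zero (Finset.mem_univ i) (sub_self _), e₂, e₃, e₄, e₅] at this
    simpa using this
  exact absurd (hr ((hroot 0).trans (hroot 1).symm)) (by decide)

end Height

theorem four_le_rpow_neg_inv {δ : ℝ} (h0 : 0 < δ) (h : δ ≤ 1 / 2) : 4 ≤ δ ^ (-(1 / δ)) := by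
  have h2 : 2 ≤ 1 / δ := by rw [le_div_iff₀ h0]; linarith
  rw [Real.rpow_neg h0.le, ← Real.inv_rpow h0.le, ← one_div]
  calc (4 : ℝ) = 2 ^ (2 : ℝ) := by norm_num
    _ ≤ (1 / δ) ^ (2 : ℝ) := by gcongr
    _ ≤ (1 / δ) ^ (1 / δ) := Real.rpow_le_rpow_of_exponent_le (by linarith) h2

/-- The numerator and the square root of the denominator of the `x`-coordinate, followed by the
integral data of the point. -/
def pointData (p : ℤ × ℤ × ℤ × ℤ × ℚ × ℚ) : (ℕ × ℕ) × (ℤ × ℤ × ℤ × ℤ × ℤ) :=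
  ((p.2.2.2.2.1.num.natAbs, p.2.2.2.2.1.den.sqrt),
    (p.1, p.2.2.2.2.2.num, p.2.1, p.2.2.1, p.2.2.2.1))

theorem pointData_spec {δ T : ℝ} (hδ : 0 < δ) (hδ' : δ ≤ 1 / 2) (hT : 0 ≤ T)
    {p : ℤ × ℤ × ℤ × ℤ × ℚ × ℚ} (hp : p ∈ SmallUpSet δ T) :
    0 < p.2.2.2.2.1.num ∧ p.2.2.2.2.1.den = (pointData p).1.2 ^ 2 ∧
      p.2.2.2.2.2.den = (pointData p).1.2 ^ 5 ∧ 0 < (pointData p).1.2 ∧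
      IsCoprime ((pointData p).1.1 : ℤ) ((pointData p).1.2 : ℤ) ∧
      ∃ H : ℝ, 1 ≤ H ∧ H ≤ T ∧ H * ((pointData p).1.2 : ℝ) ^ 2 ≤ (pointData p).1.1 ∧
        ((pointData p).1.1 : ℝ) ≤ H ^ ((25 : ℝ) / 3 - δ) ∧
        IsLargePoint H (pointData p).1.1 (pointData p).1.2 (pointData p).2 := by
  obtain ⟨a₂, a₃, a₄, a₅, x, y⟩ := p
  obtain ⟨h₂, h₃, h₄, h₅, hnd, heq, hlarge, hsmall⟩ := hp
  simp only at h₂ h₃ h₄ h₅ hnd heq hlarge hsmall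
  obtain ⟨d, hxd, hyd, ht⟩ := exists_den_eq_sq heq
  have hsqrt : x.den.sqrt = d := by rw [hxd, Nat.sqrt_eq']
  have hd : 0 < d := by
    rcases Nat.eq_zero_or_pos d with rfl | h
    · exact absurd hxd (by simp)
    · exact h
  have hdR : (0 : ℝ) < d := by exact_mod_cast hd
  have hH := one_le_Hf hnd
  obtain ⟨b₂, b₃, b₄, b₅⟩ := abs_coeff_le_Hf_pow (a₂ := a₂) (a₃ := a₃) (a₄ := a₄) (a₅ := a₅)
  set H := Hf a₂ a₃ a₄ a₅ with hHdef
  have hxR : |(x : ℝ)| = |(x.num : ℝ)| / d ^ 2 := by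
    rw [Rat.cast_def, abs_div, hxd]
    push_cast
    rw [abs_of_pos (by positivity : (0 : ℝ) < d ^ 2)]
  have hs4 : 4 * (H * d ^ 2) ≤ |(x.num : ℝ)| := by
    have h1 : 4 * H ≤ |(x.num : ℝ)| / d ^ 2 := by
      rw [← hxR]
      refine le_trans ?_ hlarge
      gcongr
      exact four_le_rpow_neg_inv hδ hδ'
    rw [le_div_iff₀ (by positivity)] at h1
    linarith
  obtain ⟨hspos, hpt⟩ := isLargePoint_of_height hH hd b₂ b₃ b₄ b₅ hs4 ht
  have hnat : ((x.num.natAbs : ℕ) : ℤ) = x.num := Int.natAbs_of_nonneg hspos.le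
  have hnatR : ((x.num.natAbs : ℕ) : ℝ) = |(x.num : ℝ)| := by
    rw [Nat.cast_natAbs, Int.cast_abs]
  simp only [pointData, hsqrt]
  refine ⟨hspos, hxd, hyd, hd, ?_, H, hH, Hf_le hT h₂ h₃ h₄ h₅, ?_, ?_, hpt⟩
  · rw [hnat]
    have := Rat.isCoprime_num_den x
    rw [hxd] at this
    push_cast at this
    exact (IsCoprime.pow_right_iff two_pos).mp this
  · rw [hnatR]
    nlinarith [show 0 < H * (d : ℝ) ^ 2 by positivity]
  · rw [hnatR]
    exact (le_max_left _ _).trans hsmall.le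

theorem pointData_injOn {δ T : ℝ} (hδ : 0 < δ) (hδ' : δ ≤ 1 / 2) (hT : 0 ≤ T) :
    Set.InjOn pointData (SmallUpSet δ T) := by
  intro p hp q hq hpq
  obtain ⟨hp₁, hp₂, hp₃, -⟩ := pointData_spec hδ hδ' hT hp
  obtain ⟨hq₁, hq₂, hq₃, -⟩ := pointData_spec hδ hδ' hT hq
  rw [hpq, ← hq₂] at hp₂
  rw [hpq, ← hq₃] at hp₃
  simp only [pointData, Prod.mk.injEq] at hpq
  obtain ⟨⟨hnum, -⟩, h₂, ht, h₃, h₄, h₅⟩ := hpq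
  refine Prod.ext h₂ (Prod.ext h₃ (Prod.ext h₄ (Prod.ext h₅ (Prod.ext ?_ ?_))))
  · refine Rat.ext ?_ hp₂
    rw [← Int.natAbs_of_nonneg hp₁.le, ← Int.natAbs_of_nonneg hq₁.le, hnum]
  · exact Rat.ext ht hp₃

theorem rpow_mul_add_one_le {T m a b c M : ℝ} (hT : 1 ≤ T)
    (h : m + max a 0 + max b 0 + max c 0 ≤ M) :
    T ^ m * ((T ^ a + 1) * ((T ^ b + 1) * (T ^ c + 1))) ≤ 8 * T ^ M := by
  have hT0 : 0 < T := by linarith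
  have key : ∀ z : ℝ, T ^ z + 1 ≤ 2 * T ^ max z 0 := by
    intro z
    have h1 : T ^ z ≤ T ^ max z 0 := Real.rpow_le_rpow_of_exponent_le hT (le_max_left _ _)
    have h2 : 1 ≤ T ^ max z 0 := Real.one_le_rpow hT (le_max_right _ _)
    linarith
  calc T ^ m * ((T ^ a + 1) * ((T ^ b + 1) * (T ^ c + 1)))
      ≤ T ^ m * ((2 * T ^ max a 0) * ((2 * T ^ max b 0) * (2 * T ^ max c 0))) := by
        gcongr <;> exact key _
    _ = 8 * T ^ (m + max a 0 + max b 0 + max c 0) := by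
        rw [Real.rpow_add hT0, Real.rpow_add hT0, Real.rpow_add hT0]; ring
    _ ≤ 8 * T ^ M := by gcongr

/-- The number of admissible tuples for given `s` and `d`, up to divisor sums, against the weight
that makes the sum over `s` and `d` converge. -/
theorem exists_height_bound {δ T s : ℝ} (hδ : 0 < δ) (hδ' : δ ≤ 1 / 10) (hT : 2 ≤ T) (hs : 1 ≤ s)
    (hsT : s ≤ T ^ ((25 : ℝ) / 3 - δ)) :
    ∃ U : ℝ, 1 ≤ U ∧ min s T ≤ U ∧
      s ^ ((36 : ℝ) / 25 + δ / 25) * (U ^ 2 * ((12 * U ^ 3 / √s + 1) *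
        ((8 * U ^ 4 / s + 1) * (4 * U ^ 5 / s + 1)))) ≤ 3072 * T ^ (14 - δ) := by
  have hT0 : 0 < T := by linarith
  have hT1 : 1 < T := by linarith
  have hs0 : 0 < s := by linarith
  obtain ⟨σ, rfl⟩ : ∃ σ : ℝ, s = T ^ σ :=
    ⟨Real.logb T s, (Real.rpow_logb hT0 hT1.ne' hs0).symm⟩
  have hσ : σ ≤ 25 / 3 - δ := (Real.rpow_le_rpow_left_iff hT1).mp hsT
  have hσ0 : 0 ≤ σ := by
    rw [← Real.rpow_zero T] at hs
    exact (Real.rpow_le_rpow_left_iff hT1).mp hs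
  have hδσ : δ * σ ≤ δ * (25 / 3) := by gcongr; linarith
  have main : ∀ u : ℝ, 0 ≤ u → (36 / 25 * σ + δ / 3 + 2 * u) + max (3 * u - σ / 2) 0 +
      max (4 * u - σ) 0 + max (5 * u - σ) 0 ≤ 14 - δ →
      (T ^ σ) ^ ((36 : ℝ) / 25 + δ / 25) * ((T ^ u) ^ 2 * ((12 * (T ^ u) ^ 3 / √(T ^ σ) + 1) *
        ((8 * (T ^ u) ^ 4 / T ^ σ + 1) * (4 * (T ^ u) ^ 5 / T ^ σ + 1)))) ≤
        3072 * T ^ (14 - δ) := by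
    intro u hu h
    have hpow : ∀ k : ℕ, (T ^ u) ^ k = T ^ (k * u) := fun k => by
      rw [← Real.rpow_natCast, ← Real.rpow_mul hT0.le, mul_comm]
    have hsqrt : √(T ^ σ) = T ^ (σ / 2) := by
      rw [Real.sqrt_eq_rpow, ← Real.rpow_mul hT0.le]; ring_nf
    have e : T ^ (14 - δ) * 3072 = 384 * (8 * T ^ (14 - δ)) := by ring
    rw [hpow, hpow, hpow, hpow, hsqrt, mul_div_assoc, mul_div_assoc, mul_div_assoc,
      ← Real.rpow_sub hT0, ← Real.rpow_sub hT0, ← Real.rpow_sub hT0, ← Real.rpow_mul hT0.le,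
      mul_comm (3072 : ℝ), e, ← mul_assoc, ← Real.rpow_add hT0]
    push_cast
    refine le_trans ?_ (mul_le_mul_of_nonneg_left
      (rpow_mul_add_one_le (m := σ * (36 / 25 + δ / 25) + 2 * u) (a := 3 * u - σ / 2)
        (b := 4 * u - σ) (c := 5 * u - σ) hT1.le
        (le_trans ?_ h)) (by norm_num))
    · have h12 : 12 * T ^ (3 * u - σ / 2) + 1 ≤ 12 * (T ^ (3 * u - σ / 2) + 1) := by linarith
      have h8 : 8 * T ^ (4 * u - σ) + 1 ≤ 8 * (T ^ (4 * u - σ) + 1) := by linarith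
      have h4 : 4 * T ^ (5 * u - σ) + 1 ≤ 4 * (T ^ (5 * u - σ) + 1) := by linarith
      calc _ ≤ T ^ (σ * (36 / 25 + δ / 25) + 2 * u) * ((12 * (T ^ (3 * u - σ / 2) + 1)) *
            ((8 * (T ^ (4 * u - σ) + 1)) * (4 * (T ^ (5 * u - σ) + 1)))) := by gcongr
        _ = _ := by ring
    · gcongr
      linarith
  rcases le_total (1 / 2) σ with h | h
  · refine ⟨T ^ (1 : ℝ), by rw [Real.rpow_one]; exact hT1.le,
      by rw [Real.rpow_one]; exact min_le_right _ _, main 1 zero_le_one ?_⟩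
    rcases max_cases (3 * 1 - σ / 2) 0 with ⟨h1, -⟩ | ⟨h1, -⟩ <;>
    rcases max_cases (4 * 1 - σ) 0 with ⟨h2, -⟩ | ⟨h2, -⟩ <;>
    rcases max_cases (5 * 1 - σ) 0 with ⟨h3, -⟩ | ⟨h3, -⟩ <;>
    rw [h1, h2, h3] <;> linarith
  · refine ⟨T ^ (1 / 2 : ℝ), Real.one_le_rpow hT1.le (by norm_num), (min_le_left _ _).trans ?_,
      main (1 / 2) (by norm_num) ?_⟩
    · exact Real.rpow_le_rpow_of_exponent_le hT1.le h
    rcases max_cases (3 * (1 / 2 : ℝ) - σ / 2) 0 with ⟨h1, -⟩ | ⟨h1, -⟩ <;>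
    rcases max_cases (4 * (1 / 2 : ℝ) - σ) 0 with ⟨h2, -⟩ | ⟨h2, -⟩ <;>
    rcases max_cases (5 * (1 / 2 : ℝ) - σ) 0 with ⟨h3, -⟩ | ⟨h3, -⟩ <;>
    rw [h1, h2, h3] <;> linarith

/-- The square root `d` of the denominator is small compared to the numerator `s`, since the
height is at least `s ^ (3 / 25)`. -/
theorem den_le_rpow {δ H s d : ℝ} (hδ : 0 < δ) (hH : 1 ≤ H) (hs : 1 ≤ s)
    (hHd : H * d ^ 2 ≤ s) (hsH : s ≤ H ^ ((25 : ℝ) / 3 - δ)) : d ≤ s ^ ((11 : ℝ) / 25) := by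
  have hs0 : 0 < s := by linarith
  have h1 : s ^ ((3 : ℝ) / 25) ≤ H := by
    calc s ^ ((3 : ℝ) / 25) ≤ (H ^ ((25 : ℝ) / 3)) ^ ((3 : ℝ) / 25) := by
          gcongr
          exact hsH.trans (Real.rpow_le_rpow_of_exponent_le hH (by linarith))
      _ = H := by rw [← Real.rpow_mul (by linarith)]; norm_num
  have h2 : s ^ ((3 : ℝ) / 25) * d ^ 2 ≤ s ^ ((3 : ℝ) / 25) * (s ^ ((11 : ℝ) / 25)) ^ 2 := by
    calc s ^ ((3 : ℝ) / 25) * d ^ 2 ≤ H * d ^ 2 := by gcongr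
      _ ≤ s := hHd
      _ = _ := by
        rw [← Real.rpow_natCast, ← Real.rpow_mul hs0.le, ← Real.rpow_add hs0]; norm_num
  exact le_of_sq_le_sq (le_of_mul_le_mul_left h2 (by positivity)) (by positivity)

theorem exists_card_le_of_subset_smallUpSet {δ : ℝ} (hδ : 0 < δ) (hδ' : δ ≤ 1 / 10) :
    ∃ C : ℝ, 0 < C ∧ ∀ T : ℝ, 2 ≤ T → ∀ F : Finset (ℤ × ℤ × ℤ × ℤ × ℚ × ℚ),
      (F : Set (ℤ × ℤ × ℤ × ℤ × ℚ × ℚ)) ⊆ SmallUpSet δ T →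
        (F.card : ℝ) ≤ C * T ^ (14 - δ) := by
  obtain ⟨C₁, hC₁, hdiv⟩ := exists_card_divisors_le_mul_rpow (ε := δ / 50 / 6) (by positivity)
  have hsum : Summable fun n : ℕ => ((n : ℝ) ^ (1 + δ / 50))⁻¹ :=
    Real.summable_nat_rpow_inv.mpr (by linarith)
  set S : ℝ := ∑' n : ℕ, ((n : ℝ) ^ (1 + δ / 50))⁻¹ with hS
  have hS0 : 0 ≤ S := tsum_nonneg fun n => by positivity
  refine ⟨18432 * C₁ * (S + 1), by positivity, fun T hT F hF => ?_⟩
  have hT0 : 0 < T := by linarith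
  have hδ2 : δ ≤ 1 / 2 := by linarith
  set G := F.image pointData with hG
  have hcard : F.card = G.card :=
    (Finset.card_image_of_injOn ((pointData_injOn hδ hδ2 hT0.le).mono hF)).symm
  set K : ℝ := 18432 * C₁ * T ^ (14 - δ) with hK
  have hK0 : 0 ≤ K := by positivity
  have hspec : ∀ z ∈ G, 0 < z.1.1 ∧ 0 < z.1.2 ∧ IsCoprime (z.1.1 : ℤ) (z.1.2 : ℤ) ∧
      ∃ H : ℝ, 1 ≤ H ∧ H ≤ T ∧ H * (z.1.2 : ℝ) ^ 2 ≤ z.1.1 ∧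
        (z.1.1 : ℝ) ≤ H ^ ((25 : ℝ) / 3 - δ) ∧ IsLargePoint H z.1.1 z.1.2 z.2 := by
    intro z hz
    obtain ⟨p, hp, rfl⟩ := Finset.mem_image.mp hz
    obtain ⟨h1, -, -, h2, h3, h4⟩ := pointData_spec hδ hδ2 hT0.le (hF hp)
    exact ⟨Int.natAbs_pos.mpr h1.ne', h2, h3, h4⟩
  set I := G.image Prod.fst with hI
  have hIspec : ∀ b ∈ I, 0 < b.1 ∧ 0 < b.2 ∧ IsCoprime (b.1 : ℤ) (b.2 : ℤ) ∧
      (b.1 : ℝ) ≤ T ^ ((25 : ℝ) / 3 - δ) ∧ (b.2 : ℝ) ≤ (b.1 : ℝ) ^ ((11 : ℝ) / 25) := by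
    intro b hb
    obtain ⟨z, hz, rfl⟩ := Finset.mem_image.mp hb
    obtain ⟨h1, h2, h3, H, hH, hHT, hHd, hsH, -⟩ := hspec z hz
    refine ⟨h1, h2, h3, hsH.trans (Real.rpow_le_rpow (by linarith) hHT (by linarith)), ?_⟩
    exact den_le_rpow hδ hH (by exact_mod_cast h1) hHd hsH
  have hfiber : ∀ b ∈ I, ((G.filter (·.1 = b)).card : ℝ) ≤
      K * ((b.1 : ℝ) ^ ((36 : ℝ) / 25 + δ / 50))⁻¹ := by
    rintro ⟨s, d⟩ hb
    obtain ⟨hs, hd, hsd, hsT, hds⟩ := hIspec _ hb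
    simp only at hs hd hsd hsT hds ⊢
    have hs1 : (1 : ℝ) ≤ s := by exact_mod_cast hs
    have hs0 : (0 : ℝ) < s := by linarith
    have hd1 : (1 : ℝ) ≤ d := by exact_mod_cast hd
    obtain ⟨U, hU, hUmin, hbound⟩ := exists_height_bound hδ hδ' hT hs1 hsT
    have hinj : Set.InjOn Prod.snd
        (G.filter (·.1 = (s, d)) : Set ((ℕ × ℕ) × (ℤ × ℤ × ℤ × ℤ × ℤ))) := by
      intro z hz z' hz' h
      rw [Finset.mem_coe, Finset.mem_filter] at hz hz'
      exact Prod.ext (hz.2.trans hz'.2.symm) h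
    have hcount := card_le_of_isLargePoint hs hd hsd hU ((G.filter (·.1 = (s, d))).image Prod.snd)
      fun q hq => by
        obtain ⟨z, hz, rfl⟩ := Finset.mem_image.mp hq
        rw [Finset.mem_filter] at hz
        obtain ⟨-, -, -, H, hH, hHT, hHd, -, hpt⟩ := hspec z hz.1
        rw [hz.2] at hHd hpt
        refine hpt.mono (by linarith) (le_trans (le_min ?_ hHT) hUmin)
        have : (1 : ℝ) ≤ (d : ℝ) ^ 2 := one_le_pow₀ hd1
        nlinarith
    rw [Finset.card_image_of_injOn hinj] at hcount
    have hτ : ((d ^ 6).divisors.card : ℝ) ≤ C₁ * (s : ℝ) ^ (δ / 50) := by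
      refine (hdiv (d ^ 6) (by positivity)).trans ?_
      gcongr
      push_cast
      have hds' : (d : ℝ) ≤ s := by
        refine hds.trans ?_
        calc (s : ℝ) ^ ((11 : ℝ) / 25) ≤ (s : ℝ) ^ (1 : ℝ) :=
              Real.rpow_le_rpow_of_exponent_le hs1 (by norm_num)
          _ = s := Real.rpow_one _
      calc ((d : ℝ) ^ 6) ^ (δ / 50 / 6) ≤ ((s : ℝ) ^ 6) ^ (δ / 50 / 6) := by gcongr
        _ = (s : ℝ) ^ (δ / 50) := by
            rw [← Real.rpow_natCast, ← Real.rpow_mul hs0.le]; congr 1; push_cast; ring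
    rw [← div_eq_mul_inv, le_div_iff₀ (by positivity)]
    calc ((G.filter (·.1 = (s, d))).card : ℝ) * (s : ℝ) ^ ((36 : ℝ) / 25 + δ / 50)
        ≤ 3 * U ^ 2 * (2 * (C₁ * (s : ℝ) ^ (δ / 50)) * (2 * (6 * U ^ 3 / √s) + 1) *
          ((4 * (2 * U ^ 4) / s + 1) * (4 * U ^ 5 / s + 1))) *
            (s : ℝ) ^ ((36 : ℝ) / 25 + δ / 50) := by
          gcongr
          refine hcount.trans ?_
          gcongr
      _ = 6 * C₁ * ((s : ℝ) ^ ((36 : ℝ) / 25 + δ / 25) * (U ^ 2 * ((12 * U ^ 3 / √s + 1) *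
            ((8 * U ^ 4 / s + 1) * (4 * U ^ 5 / s + 1))))) := by
          have e : (s : ℝ) ^ ((36 : ℝ) / 25 + δ / 25) =
              (s : ℝ) ^ (δ / 50) * (s : ℝ) ^ ((36 : ℝ) / 25 + δ / 50) := by
            rw [← Real.rpow_add hs0]; ring_nf
          rw [e]; ring
      _ ≤ 6 * C₁ * (3072 * T ^ (14 - δ)) := by gcongr
      _ = K := by rw [hK]; ring
  have hrow : ∀ s ∈ I.image Prod.fst, ∑ b ∈ I.filter (·.1 = s),
      K * ((b.1 : ℝ) ^ ((36 : ℝ) / 25 + δ / 50))⁻¹ ≤ K * ((s : ℝ) ^ (1 + δ / 50))⁻¹ := by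
    intro s hs
    obtain ⟨b₀, hb₀, rfl⟩ := Finset.mem_image.mp hs
    have hs0 : (0 : ℝ) < b₀.1 := by exact_mod_cast (hIspec b₀ hb₀).1
    have hcardrow : ((I.filter (·.1 = b₀.1)).card : ℝ) ≤ (b₀.1 : ℝ) ^ ((11 : ℝ) / 25) := by
      have : (I.filter (·.1 = b₀.1)).card ≤
          (Finset.Icc 1 ⌊(b₀.1 : ℝ) ^ ((11 : ℝ) / 25)⌋₊).card := by
        refine Finset.card_le_card_of_injOn Prod.snd (fun b hb => ?_) fun b hb b' hb' h => ?_
        · rw [Finset.mem_coe, Finset.mem_filter] at hb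
          obtain ⟨-, h2, -, -, h5⟩ := hIspec b hb.1
          rw [hb.2] at h5
          exact Finset.mem_coe.mpr (Finset.mem_Icc.mpr ⟨h2, Nat.le_floor h5⟩)
        · rw [Finset.mem_coe, Finset.mem_filter] at hb hb'
          exact Prod.ext (hb.2.trans hb'.2.symm) h
      rw [Nat.card_Icc, Nat.add_sub_cancel] at this
      exact (Nat.cast_le.mpr this).trans (Nat.floor_le (by positivity))
    calc ∑ b ∈ I.filter (·.1 = b₀.1), K * ((b.1 : ℝ) ^ ((36 : ℝ) / 25 + δ / 50))⁻¹
        = ∑ b ∈ I.filter (·.1 = b₀.1), K * ((b₀.1 : ℝ) ^ ((36 : ℝ) / 25 + δ / 50))⁻¹ :=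
          Finset.sum_congr rfl fun b hb => by rw [(Finset.mem_filter.mp hb).2]
      _ = (I.filter (·.1 = b₀.1)).card * (K * ((b₀.1 : ℝ) ^ ((36 : ℝ) / 25 + δ / 50))⁻¹) := by
          rw [Finset.sum_const, nsmul_eq_mul]
      _ ≤ (b₀.1 : ℝ) ^ ((11 : ℝ) / 25) * (K * ((b₀.1 : ℝ) ^ ((36 : ℝ) / 25 + δ / 50))⁻¹) := by
          gcongr
      _ = K * ((b₀.1 : ℝ) ^ (1 + δ / 50))⁻¹ := by
          rw [mul_left_comm, ← Real.rpow_neg hs0.le, ← Real.rpow_neg hs0.le,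
            ← Real.rpow_add hs0]
          ring_nf
  calc (F.card : ℝ) = ∑ b ∈ I, ((G.filter (·.1 = b)).card : ℝ) := by
        rw [hcard, Finset.card_eq_sum_card_image Prod.fst G, Nat.cast_sum]
    _ ≤ ∑ b ∈ I, K * ((b.1 : ℝ) ^ ((36 : ℝ) / 25 + δ / 50))⁻¹ := Finset.sum_le_sum hfiber
    _ = ∑ s ∈ I.image Prod.fst, ∑ b ∈ I.filter (·.1 = s),
          K * ((b.1 : ℝ) ^ ((36 : ℝ) / 25 + δ / 50))⁻¹ :=
        (Finset.sum_fiberwise_of_maps_to (fun b hb => Finset.mem_image_of_mem _ hb) _).symm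
    _ ≤ ∑ s ∈ I.image Prod.fst, K * ((s : ℝ) ^ (1 + δ / 50))⁻¹ := Finset.sum_le_sum hrow
    _ = K * ∑ s ∈ I.image Prod.fst, ((s : ℝ) ^ (1 + δ / 50))⁻¹ := by rw [Finset.mul_sum]
    _ ≤ K * (S + 1) := by
        gcongr
        exact (hsum.sum_le_tsum _ fun n _ => by positivity).trans (by linarith)
    _ = _ := by rw [hK]; ring

theorem Set.finite_and_ncard_le_of_forall_finset {α : Type*} {A : Set α} {B : ℝ}
    (h : ∀ F : Finset α, (F : Set α) ⊆ A → (F.card : ℝ) ≤ B) :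
    A.Finite ∧ (A.ncard : ℝ) ≤ B := by
  have hfin : A.Finite := by
    by_contra hinf
    obtain ⟨n, hn⟩ := exists_nat_gt B
    obtain ⟨F, hF, hcard⟩ := Set.Infinite.exists_subset_card_eq hinf n
    have := h F hF
    rw [hcard] at this
    linarith
  refine ⟨hfin, ?_⟩
  rw [Set.ncard_eq_toFinset_card A hfin]
  exact h _ (by simp)

/-- The total number of small points with large `x`-coordinate in the family of height at
most `T` is `O(T^(14 - c))`. -/
theorem count_small_points_with_large_x :
    ∃ δ₀ : ℝ, 0 < δ₀ ∧ ∀ δ : ℝ, 0 < δ → δ < δ₀ →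
      ∃ c C : ℝ, 0 < c ∧ 0 < C ∧ ∀ T : ℝ, 2 ≤ T →
        (SmallUpSet δ T).Finite ∧
        ((SmallUpSet δ T).ncard : ℝ) ≤ C * T ^ ((14 : ℝ) - c) := by
  refine ⟨1 / 10, by norm_num, fun δ hδ hδ' => ?_⟩
  obtain ⟨C, hC, h⟩ := exists_card_le_of_subset_smallUpSet hδ hδ'.le
  exact ⟨δ, C, hδ, hC, fun T hT => Set.finite_and_ncard_le_of_forall_finset (h T hT)⟩
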